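/- (Main theorem, β = 2 case) Suppose n ≥ 2L/s and set α = 2. Initialize the Finito table with all entries equal to a common point x₀ ∈ E, and run the Finito iteration: at each step, given the current table φ, compute w = φ̄ − (1/(2sn))∑_i ∇f_i(φ_i) and replace entry j by w. Then, averaging uniformly over all index sequences σ ∈ {1,…,n}^k of length k, the mean φ̄^{(k)}(σ) of the table after k steps following σ satisfies (1/n^k)∑_{σ∈{1,…,n}^k} f(φ̄^{(k)}(σ)) − f(w*) ≤ (3/(4s)) · (1 − 1/(2n))^k · ‖∇f(x₀)‖², where w* is a minimizer of f. -/

import Mathlib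

open RealInnerProductSpace Finset

section Smooth

variable {E : Type*} [NormedAddCommGroup E] [InnerProductSpace ℝ E] [CompleteSpace E]

/-- The derivative of a differentiable function along a line, in terms of its gradient. -/
lemma Differentiable.hasDerivAt_comp_add_smul {f : E → ℝ} (hf : Differentiable ℝ f)
    (x v : E) (t : ℝ) :
    HasDerivAt (fun t : ℝ => f (x + t • v)) ⟪gradient f (x + t • v), v⟫ t := by
  have h1 : HasDerivAt (fun t : ℝ => x + t • v) v t := by
    simpa using ((hasDerivAt_id t).smul_const v).const_add x
  have h2 := (hf (x + t • v)).hasFDerivAt.comp_hasDerivAt t h1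
  rwa [← inner_gradient_left] at h2

/-- The descent lemma: a function with `L`-Lipschitz gradient has quadratic upper bounds. -/
lemma le_add_inner_gradient_add_of_lipschitz {f : E → ℝ} (hf : Differentiable ℝ f) {L : ℝ}
    (hlip : ∀ x y, ‖gradient f x - gradient f y‖ ≤ L * ‖x - y‖) (x y : E) :
    f y ≤ f x + ⟪gradient f x, y - x⟫ + L / 2 * ‖y - x‖ ^ 2 := by
  set v := y - x with hv
  have hd : ∀ t : ℝ, HasDerivAt
      (fun t : ℝ => f (x + t • v) - t * ⟪gradient f x, v⟫ - L / 2 * ‖v‖ ^ 2 * t ^ 2)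
      (⟪gradient f (x + t • v), v⟫ - ⟪gradient f x, v⟫ - L * ‖v‖ ^ 2 * t) t := by
    intro t
    have h := ((hf.hasDerivAt_comp_add_smul x v t).sub
      ((hasDerivAt_id t).mul_const ⟪gradient f x, v⟫)).sub
      (((hasDerivAt_id t).pow 2).const_mul (L / 2 * ‖v‖ ^ 2))
    refine HasDerivAt.congr_deriv h ?_
    simp
    ring
  have hanti := antitoneOn_of_hasDerivWithinAt_nonpos (convex_Icc (0 : ℝ) 1)
    (fun t _ => (hd t).continuousAt.continuousWithinAt)
    (fun t _ => (hd t).hasDerivWithinAt) (by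
      intro t ht
      have ht0 : 0 ≤ t := by
        rw [interior_Icc] at ht
        exact ht.1.le
      have h1 := real_inner_le_norm (gradient f (x + t • v) - gradient f x) v
      have h2 := hlip (x + t • v) x
      rw [add_sub_cancel_left, norm_smul, Real.norm_of_nonneg ht0] at h2
      rw [inner_sub_left] at h1
      nlinarith [mul_le_mul_of_nonneg_right h2 (norm_nonneg v)])
  have h := hanti (Set.left_mem_Icc.2 zero_le_one) (Set.right_mem_Icc.2 zero_le_one) zero_le_one
  have hy : x + v = y := by simp [hv]
  simp only [one_smul, zero_smul, hy, add_zero] at h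
  linarith

/-- A differentiable strongly convex function has quadratic lower bounds. -/
lemma StrongConvexOn.add_inner_gradient_add_le {f : E → ℝ} {s : ℝ}
    (hsc : StrongConvexOn Set.univ s f) (hf : Differentiable ℝ f) (x y : E) :
    f x + ⟪gradient f x, y - x⟫ + s / 2 * ‖y - x‖ ^ 2 ≤ f y := by
  set v := y - x with hv
  have hc := (strongConvexOn_iff_convex.1 hsc).comp_affineMap (AffineMap.lineMap x y)
  have hd : HasDerivAt ((fun x => f x - s / 2 * ‖x‖ ^ 2) ∘ (AffineMap.lineMap x y : ℝ →ᵃ[ℝ] E))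
      (⟪gradient f x, v⟫ - s * ⟪x, v⟫) 0 := by
    have h1 := hf.hasDerivAt_comp_add_smul x v 0
    have h2 : HasDerivAt (fun t : ℝ => x + t • v) v 0 := by
      simpa using ((hasDerivAt_id (0 : ℝ)).smul_const v).const_add x
    have h := h1.sub (h2.norm_sq.const_mul (s / 2))
    simp only [zero_smul, add_zero] at h
    have hline : (fun x => f x - s / 2 * ‖x‖ ^ 2) ∘ (AffineMap.lineMap x y : ℝ →ᵃ[ℝ] E) =
        (fun t : ℝ => f (x + t • v)) - fun t => s / 2 * ‖x + t • v‖ ^ 2 := by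
      ext t
      simp [AffineMap.lineMap_apply, hv, add_comm]
    rw [hline]
    exact h.congr_deriv (by ring)
  have h := hc.le_slope_of_hasDerivAt (x := 0) (y := 1) trivial trivial zero_lt_one hd
  have hxy : ‖y‖ ^ 2 = ‖x‖ ^ 2 + 2 * ⟪x, v⟫ + ‖v‖ ^ 2 := by
    rw [← norm_add_sq_real, hv, add_sub_cancel]
  simp only [slope_def_field, Function.comp_apply, AffineMap.lineMap_apply_one,
    AffineMap.lineMap_apply_zero, sub_zero, div_one] at h
  rw [hxy] at h
  linarith

/-- The interpolation inequality for strongly convex functions with Lipschitz gradient. -/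
lemma StrongConvexOn.add_inner_gradient_add_norm_sq_le {f : E → ℝ} {s L : ℝ} (hL : 0 < L)
    (hsc : StrongConvexOn Set.univ s f) (hf : Differentiable ℝ f) (hs : 0 ≤ s)
    (hlip : ∀ x y, ‖gradient f x - gradient f y‖ ≤ L * ‖x - y‖) (x y : E) :
    f x + ⟪gradient f x, y - x⟫ + s / 2 * ‖y - x‖ ^ 2
      + 1 / (2 * L) * ‖gradient f y - gradient f x - s • (y - x)‖ ^ 2 ≤ f y := by
  set u := gradient f y - gradient f x - s • (y - x) with hu
  set v := y - x with hv
  have hx := hsc.add_inner_gradient_add_le hf x (y - (1 / L) • u)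
  have hy := le_add_inner_gradient_add_of_lipschitz hf hlip y (y - (1 / L) • u)
  have hg : gradient f y = u + gradient f x + s • v := by rw [hu]; abel
  have e1 : y - (1 / L) • u - x = v - (1 / L) • u := by rw [hv]; abel
  have e2 : y - (1 / L) • u - y = -((1 / L) • u) := by abel
  rw [e1] at hx
  rw [e2, hg] at hy
  simp only [← real_inner_self_eq_norm_sq, inner_sub_left, inner_sub_right, inner_add_left,
    inner_neg_left, inner_neg_right, real_inner_smul_left, real_inner_smul_right,
    real_inner_comm u v] at hx hy ⊢
  have hLL : L * (1 / L) = 1 := by field_simp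
  have hp : 0 ≤ s / 2 * (1 / L) ^ 2 * ⟪u, u⟫ := by
    have := real_inner_self_nonneg (x := u)
    positivity
  have e3 : 1 / (2 * L) = (1 / L) / 2 := by field_simp
  rw [e3]
  linear_combination hx + hy + hp + (1 / 2) * (1 / L) * ⟪u, u⟫ * hLL

end Smooth

section Finito

variable {E : Type*} [NormedAddCommGroup E] [InnerProductSpace ℝ E]

/-- The scalar inequality behind one Finito step for a single component: `δ` is the increment
`w - φ_j`, `h` the change of the gradient and `D` the Bregman divergence of `f_j`. -/
lemma finito_step_remainder_le {s L r D : ℝ} (hs : 0 < s) (hL : 0 < L) (hr : 0 ≤ r)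
    (hrL : r * (2 * L) ≤ s) {δ h : E}
    (hlow : s / 2 * ‖δ‖ ^ 2 + 1 / (2 * L) * ‖h - s • δ‖ ^ 2 ≤ D)
    (hmono : 0 ≤ ⟪h - s • δ, δ⟫) :
    r * (L / 2 * ‖δ‖ ^ 2 - ⟪h, δ⟫ + 3 / (8 * s) * ‖h‖ ^ 2) ≤ D / 2 := by
  obtain ⟨u, rfl⟩ : ∃ u, h = u + s • δ := ⟨h - s • δ, by abel⟩
  rw [add_sub_cancel_right] at hlow hmono
  have hu := sq_nonneg ‖u‖
  have hδ := sq_nonneg ‖δ‖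
  rw [norm_add_sq_real, inner_add_left, real_inner_smul_left, real_inner_smul_right,
    norm_smul, mul_pow, real_inner_self_eq_norm_sq, Real.norm_of_nonneg hs.le]
  set a := ‖δ‖ ^ 2
  set b := ‖u‖ ^ 2
  set c := ⟪u, δ⟫
  have hb : r * (3 / (8 * s) * b) ≤ 1 / (2 * L) * b / 2 := by
    have : r * (3 / (8 * s)) ≤ 1 / (2 * L) / 2 := by
      rw [← mul_div_assoc, div_div, div_le_div_iff₀ (by positivity) (by positivity)]
      nlinarith
    nlinarith
  have ha : r * (L / 2 * a) ≤ s / 4 * a := by nlinarith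
  have e : r * (L / 2 * a - (c + s * a) + 3 / (8 * s) * (b + 2 * (s * c) + s ^ 2 * a)) =
      r * (L / 2 * a) + r * (3 / (8 * s) * b) - r * (c / 4) - r * (5 / 8 * s * a) := by
    field_simp
    ring
  rw [e]
  have h1 : 0 ≤ r * (c / 4) := by positivity
  have h2 : 0 ≤ r * (5 / 8 * s * a) := by positivity
  linarith

/-- Replacing one entry of a table changes a sum over the table by one summand. -/
lemma sum_apply_update {ι α M : Type*} [Fintype ι] [DecidableEq ι] [AddCommGroup M]
    (H : ι → α → M) (φ : ι → α) (j : ι) (w : α) :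
    ∑ i, H i (Function.update φ j w i) = ∑ i, H i (φ i) + (H j w - H j (φ j)) := by
  rw [← sub_eq_iff_eq_add', ← Finset.sum_sub_distrib, Finset.sum_eq_single j]
  · simp
  · intro i _ hij
    simp [hij]
  · simp

variable {n : ℕ}

/-- The mean of a table. -/
noncomputable def tableMean (φ : Fin n → E) : E := (1 / (n : ℝ)) • ∑ i, φ i

lemma tableMean_sub_const (hn : 1 ≤ n) (φ : Fin n → E) (x : E) :
    ∑ i, (x - φ i) = (n : ℝ) • (x - tableMean φ) := by
  have : (n : ℝ) ≠ 0 := by positivity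
  rw [Finset.sum_sub_distrib, smul_sub, tableMean, smul_smul, mul_one_div_cancel this]
  simp [← Nat.cast_smul_eq_nsmul ℝ]

lemma sum_eq_smul_tableMean (hn : 1 ≤ n) (φ : Fin n → E) :
    ∑ i, φ i = (n : ℝ) • tableMean φ := by
  have : (n : ℝ) ≠ 0 := by positivity
  rw [tableMean, smul_smul, mul_one_div_cancel this, one_smul]

lemma tableMean_update (φ : Fin n → E) (j : Fin n) (w : E) (g : Fin n → E → E) :
    tableMean (fun i => g i (Function.update φ j w i)) =
      tableMean (fun i => g i (φ i)) + (1 / (n : ℝ)) • (g j w - g j (φ j)) := by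
  rw [tableMean, sum_apply_update g, smul_add, tableMean]

variable [CompleteSpace E]

/-- The mean of the stored gradients. -/
noncomputable def meanGradient (f : Fin n → E → ℝ) (φ : Fin n → E) : E :=
  tableMean fun i => gradient (f i) (φ i)

/-- The sum of the linearizations of the components at the table entries, evaluated at `x`. -/
noncomputable def sumLinearization (f : Fin n → E → ℝ) (φ : Fin n → E) (x : E) : ℝ :=
  ∑ i, (f i (φ i) + ⟪gradient (f i) (φ i), x - φ i⟫)

/-- The point inserted into the table by a Finito step with step size `2`. -/
noncomputable def finitoPoint (s : ℝ) (f : Fin n → E → ℝ) (φ : Fin n → E) : E :=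
  tableMean φ - (1 / (2 * s)) • meanGradient f φ

/-- The Lyapunov function of the Finito iteration, multiplied by the number of components. -/
noncomputable def finitoPotential (s : ℝ) (f : Fin n → E → ℝ) (φ : Fin n → E) : ℝ :=
  ∑ i, f i (tableMean φ) - sumLinearization f φ (tableMean φ)
    + n * (3 / (8 * s) * ‖meanGradient f φ‖ ^ 2)

lemma sumLinearization_eq (hn : 1 ≤ n) (f : Fin n → E → ℝ) (φ : Fin n → E) (x y : E) :
    sumLinearization f φ y = sumLinearization f φ x + n * ⟪meanGradient f φ, y - x⟫ := by
  have h := sum_eq_smul_tableMean hn fun i => gradient (f i) (φ i)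
  rw [← meanGradient] at h
  rw [← real_inner_smul_left, ← h, sum_inner, sumLinearization, sumLinearization,
    ← Finset.sum_add_distrib]
  refine Finset.sum_congr rfl fun i _ => ?_
  rw [add_assoc, ← inner_add_right]
  congr 3
  abel

lemma sumLinearization_update (f : Fin n → E → ℝ) (φ : Fin n → E) (j : Fin n) (w x : E) :
    sumLinearization f (Function.update φ j w) x = sumLinearization f φ x
      + (f j w + ⟪gradient (f j) w, x - w⟫
        - (f j (φ j) + ⟪gradient (f j) (φ j), x - φ j⟫)) :=
  sum_apply_update (fun i z => f i z + ⟪gradient (f i) z, x - z⟫) φ j w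

lemma sum_le_sum_add_inner_gradient {f : Fin n → E → ℝ} (hn : 1 ≤ n)
    (hdiff : ∀ i, Differentiable ℝ (f i)) {L : ℝ}
    (hlip : ∀ i, ∀ x y : E, ‖gradient (f i) x - gradient (f i) y‖ ≤ L * ‖x - y‖) (x y : E) :
    ∑ i, f i y ≤ ∑ i, f i x + n * ⟪meanGradient f fun _ => x, y - x⟫
      + n * (L / 2 * ‖y - x‖ ^ 2) := by
  have h := sumLinearization_eq hn f (fun _ => x) x y
  have h' := Finset.sum_le_sum fun i (_ : i ∈ Finset.univ) =>
    le_add_inner_gradient_add_of_lipschitz (hdiff i) (hlip i) x y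
  simp only [sumLinearization, sub_self, inner_zero_right, add_zero] at h
  rw [Finset.sum_add_distrib, h] at h'
  simpa using h'

lemma sum_add_inner_gradient_le_sum {f : Fin n → E → ℝ} (hn : 1 ≤ n)
    (hdiff : ∀ i, Differentiable ℝ (f i)) {s : ℝ}
    (hsc : ∀ i, StrongConvexOn Set.univ s (f i)) (x y : E) :
    ∑ i, f i x + n * ⟪meanGradient f fun _ => x, y - x⟫
      + n * (s / 2 * ‖y - x‖ ^ 2) ≤ ∑ i, f i y := by
  have h := sumLinearization_eq hn f (fun _ => x) x y
  have h' := Finset.sum_le_sum fun i (_ : i ∈ Finset.univ) =>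
    (hsc i).add_inner_gradient_add_le (hdiff i) x y
  simp only [sumLinearization, sub_self, inner_zero_right, add_zero] at h
  rw [Finset.sum_add_distrib, h] at h'
  simpa using h'

/-- The change of the Lyapunov function when the `j`-th entry is replaced. -/
lemma finitoPotential_update_le {f : Fin n → E → ℝ} (hn : 1 ≤ n)
    (hdiff : ∀ i, Differentiable ℝ (f i)) {s L : ℝ} (hs : 0 < s) (hL : 0 < L)
    (hsc : ∀ i, StrongConvexOn Set.univ s (f i))
    (hlip : ∀ i, ∀ x y : E, ‖gradient (f i) x - gradient (f i) y‖ ≤ L * ‖x - y‖)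
    (hbig : 2 * L ≤ s * n) (φ : Fin n → E) (j : Fin n) :
    finitoPotential s f (Function.update φ j (finitoPoint s f φ)) ≤
      finitoPotential s f φ
        + ⟪(meanGradient f fun _ => tableMean φ) - meanGradient f φ, finitoPoint s f φ - φ j⟫
        - (f j (finitoPoint s f φ)
          - (f j (φ j) + ⟪gradient (f j) (φ j), finitoPoint s f φ - φ j⟫)) / 2
        + 1 / (4 * s) * ⟪meanGradient f φ,
          gradient (f j) (finitoPoint s f φ) - gradient (f j) (φ j)⟫ := by
  have hn0 : (0 : ℝ) < n := by positivity
  have hm : tableMean (Function.update φ j (finitoPoint s f φ)) =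
      tableMean φ + (1 / (n : ℝ)) • (finitoPoint s f φ - φ j) :=
    tableMean_update φ j _ fun _ z => z
  have hG : meanGradient f (Function.update φ j (finitoPoint s f φ)) =
      meanGradient f φ + (1 / (n : ℝ)) •
        (gradient (f j) (finitoPoint s f φ) - gradient (f j) (φ j)) :=
    tableMean_update φ j _ fun i => gradient (f i)
  have hw : tableMean φ = finitoPoint s f φ + (1 / (2 * s)) • meanGradient f φ := by
    simp [finitoPoint]
  rw [finitoPotential, sumLinearization_update, hG, hm,
    sumLinearization_eq hn f φ (tableMean φ), finitoPotential]
  have hF := sum_le_sum_add_inner_gradient hn hdiff hlip (tableMean φ)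
    (tableMean φ + (1 / (n : ℝ)) • (finitoPoint s f φ - φ j))
  have hlow := (hsc j).add_inner_gradient_add_norm_sq_le hL (hdiff j) hs.le (hlip j) (φ j)
    (finitoPoint s f φ)
  have hmon1 := (hsc j).add_inner_gradient_add_le (hdiff j) (φ j) (finitoPoint s f φ)
  have hmon2 := (hsc j).add_inner_gradient_add_le (hdiff j) (finitoPoint s f φ) (φ j)
  generalize (meanGradient f fun _ => tableMean φ) = q at *
  generalize meanGradient f φ = G at *
  generalize finitoPoint s f φ = w at *
  generalize gradient (f j) w = g' at *
  generalize gradient (f j) (φ j) = g at *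
  generalize ∑ i, f i (tableMean φ + (1 / (n : ℝ)) • (w - φ j)) = F' at *
  generalize ∑ i, f i (tableMean φ) = F at *
  generalize tableMean φ = m at *
  subst hw
  obtain ⟨δ, rfl⟩ : ∃ δ, w = φ j + δ := ⟨w - φ j, by abel⟩
  obtain ⟨h, rfl⟩ : ∃ h, g' = g + h := ⟨g' - g, by abel⟩
  generalize φ j = z at *
  simp only [add_sub_cancel_left] at *
  rw [sub_add_cancel_left, inner_neg_right, inner_add_left, norm_neg] at hmon2
  have hrem := finito_step_remainder_le (r := 1 / (n : ℝ)) (D := f j (z + δ) - f j z - ⟪g, δ⟫)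
    (δ := δ) (h := h) hs hL (by positivity)
    (by rw [div_mul_eq_mul_div, one_mul, div_le_iff₀ hn0]; exact hbig)
    (by linarith) (by
      rw [inner_sub_left, real_inner_smul_left, real_inner_self_eq_norm_sq]
      linarith)
  have e1 : z + δ + (1 / (2 * s)) • G + (1 / (n : ℝ)) • δ - (z + δ) =
    (1 / (2 * s)) • G + (1 / (n : ℝ)) • δ := by abel
  have e2 : z + δ + (1 / (2 * s)) • G + (1 / (n : ℝ)) • δ - z =
    δ + (1 / (2 * s)) • G + (1 / (n : ℝ)) • δ := by abel
  rw [e1, e2]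
  simp only [← real_inner_self_eq_norm_sq, inner_sub_left, inner_add_left,
    inner_add_right, real_inner_smul_left, real_inner_smul_right,
    real_inner_comm G h] at hF hrem ⊢
  have hnr : (n : ℝ) * (1 / n) = 1 := by field_simp
  have hs1 : 1 / (2 * s) = 1 / s / 2 := by field_simp
  have hs2 : 1 / (4 * s) = 1 / s / 4 := by field_simp
  have hs3 : 3 / (8 * s) = 3 * (1 / s) / 8 := by field_simp
  rw [hs3] at hrem ⊢
  rw [hs1, hs2]
  generalize 1 / s = t at *
  generalize (1 : ℝ) / n = r at *
  linear_combination hF + hrem + (-⟪G, δ⟫ + 3 / 4 * t * ⟪G, h⟫ + ⟪q, δ⟫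
    + 3 / 8 * r * t * ⟪h, h⟫ + 1 / 2 * r * L * ⟪δ, δ⟫) * hnr

/-- One Finito step contracts the Lyapunov function on average over the replaced index. -/
lemma sum_finitoPotential_update_le {f : Fin n → E → ℝ} (hn : 1 ≤ n)
    (hdiff : ∀ i, Differentiable ℝ (f i)) {s L : ℝ} (hs : 0 < s) (hL : 0 < L)
    (hsc : ∀ i, StrongConvexOn Set.univ s (f i))
    (hlip : ∀ i, ∀ x y : E, ‖gradient (f i) x - gradient (f i) y‖ ≤ L * ‖x - y‖)
    (hbig : 2 * L ≤ s * n) (φ : Fin n → E) :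
    ∑ j, finitoPotential s f (Function.update φ j (finitoPoint s f φ)) ≤
      (n - 1 / 2) * finitoPotential s f φ := by
  refine (Finset.sum_le_sum fun j _ =>
    finitoPotential_update_le hn hdiff hs hL hsc hlip hbig φ j).trans ?_
  have hδ := tableMean_sub_const hn φ (finitoPoint s f φ)
  have hh : ∑ j, (gradient (f j) (finitoPoint s f φ) - gradient (f j) (φ j)) =
      (n : ℝ) • ((meanGradient f fun _ => finitoPoint s f φ) - meanGradient f φ) := by
    rw [Finset.sum_sub_distrib, sum_eq_smul_tableMean hn,
      sum_eq_smul_tableMean hn fun i => gradient (f i) (φ i), ← smul_sub]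
    rfl
  rw [Finset.sum_add_distrib, Finset.sum_sub_distrib, Finset.sum_add_distrib,
    ← Finset.sum_div, ← Finset.mul_sum, ← inner_sum, ← inner_sum,
    hδ, hh, Finset.sum_sub_distrib, ← sumLinearization, sumLinearization_eq hn f φ (tableMean φ)]
  have h1 := sum_add_inner_gradient_le_sum hn hdiff hsc (tableMean φ) (finitoPoint s f φ)
  have h2 := sum_add_inner_gradient_le_sum hn hdiff hsc (finitoPoint s f φ) (tableMean φ)
  have hd : finitoPoint s f φ - tableMean φ = -((1 / (2 * s)) • meanGradient f φ) := by
    simp [finitoPoint]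
  rw [← neg_sub, hd, neg_neg] at h2
  rw [hd] at h1 ⊢
  simp only [finitoPotential, ← real_inner_self_eq_norm_sq, inner_sub_left, inner_sub_right,
    inner_neg_left, inner_neg_right, real_inner_smul_right, Finset.sum_const, Finset.card_univ, Fintype.card_fin, nsmul_eq_mul,
    real_inner_comm (meanGradient f φ)] at h1 h2 ⊢
  generalize (meanGradient f fun _ => finitoPoint s f φ) = p at *
  generalize (meanGradient f fun _ => tableMean φ) = q at *
  generalize meanGradient f φ = G at *
  have hs1 : 1 / (2 * s) = 1 / s / 2 := by field_simp
  have hs2 : 1 / (4 * s) = 1 / s / 4 := by field_simp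
  have hs3 : 3 / (8 * s) = 3 * (1 / s) / 8 := by field_simp
  have hss : s * (1 / s) = 1 := by field_simp
  rw [hs1] at h1 h2 ⊢
  rw [hs2, hs3]
  generalize 1 / s = t at *
  linear_combination h1 + h2 / 2 - 3 / 16 * n * t * ⟪G, G⟫ * hss

/-- The suboptimality at the table mean is controlled by the Lyapunov function. -/
lemma sum_sub_sum_le_finitoPotential {f : Fin n → E → ℝ} (hn : 1 ≤ n)
    (hdiff : ∀ i, Differentiable ℝ (f i)) {s : ℝ} (hs : 0 < s)
    (hsc : ∀ i, StrongConvexOn Set.univ s (f i)) (φ : Fin n → E) (x : E) :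
    ∑ i, f i (tableMean φ) - ∑ i, f i x ≤ 2 * finitoPotential s f φ := by
  have hlin (y : E) : sumLinearization f φ y + ∑ i, s / 2 * ‖y - φ i‖ ^ 2 ≤ ∑ i, f i y := by
    rw [sumLinearization, ← Finset.sum_add_distrib]
    exact Finset.sum_le_sum fun i _ => (hsc i).add_inner_gradient_add_le (hdiff i) (φ i) y
  have hm := hlin (tableMean φ)
  have hm0 : 0 ≤ ∑ i, s / 2 * ‖tableMean φ - φ i‖ ^ 2 := by positivity
  have hx := hlin x
  have hquad : n * (-⟪meanGradient f φ, x - tableMean φ⟫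
      - 1 / (2 * s) * ‖meanGradient f φ‖ ^ 2) ≤ ∑ i, s / 2 * ‖x - φ i‖ ^ 2 := by
    have hsum : n * (-⟪meanGradient f φ, x - tableMean φ⟫
        - 1 / (2 * s) * ‖meanGradient f φ‖ ^ 2) =
        ∑ i, (-⟪meanGradient f φ, x - φ i⟫ - 1 / (2 * s) * ‖meanGradient f φ‖ ^ 2) := by
      rw [Finset.sum_sub_distrib, Finset.sum_neg_distrib, ← inner_sum,
        tableMean_sub_const hn, real_inner_smul_right]
      simp
      ring
    rw [hsum]
    refine Finset.sum_le_sum fun i _ => ?_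
    have h0 : 0 ≤ s / 2 * ‖(1 / s) • meanGradient f φ + (x - φ i)‖ ^ 2 := by positivity
    rw [norm_add_sq_real, real_inner_smul_left, norm_smul, mul_pow,
      Real.norm_of_nonneg (by positivity)] at h0
    have e : ∀ a b c : ℝ, s / 2 * ((1 / s) ^ 2 * a + 2 * (1 / s * b) + c) =
        1 / (2 * s) * a + b + s / 2 * c := by
      intro a b c
      field_simp
    rw [e] at h0
    linarith
  rw [sumLinearization_eq hn f φ (tableMean φ)] at hx
  have hG : 0 ≤ (n : ℝ) * (1 / (4 * s) * ‖meanGradient f φ‖ ^ 2) := by positivity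
  have hs1 : 1 / (2 * s) = 1 / s / 2 := by field_simp
  have hs2 : 1 / (4 * s) = 1 / s / 4 := by field_simp
  have hs3 : 3 / (8 * s) = 3 * (1 / s) / 8 := by field_simp
  rw [finitoPotential, hs3]
  rw [hs1] at hquad
  rw [hs2] at hG
  linarith

/-- The Lyapunov function after `k` Finito steps, summed over all index sequences. -/
lemma sum_finitoPotential_foldl_le {f : Fin n → E → ℝ} (hn : 1 ≤ n)
    (hdiff : ∀ i, Differentiable ℝ (f i)) {s L : ℝ} (hs : 0 < s) (hL : 0 < L)
    (hsc : ∀ i, StrongConvexOn Set.univ s (f i))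
    (hlip : ∀ i, ∀ x y : E, ‖gradient (f i) x - gradient (f i) y‖ ≤ L * ‖x - y‖)
    (hbig : 2 * L ≤ s * n) (k : ℕ) (φ : Fin n → E) :
    ∑ σ : Fin k → Fin n, finitoPotential s f ((List.ofFn σ).foldl
      (fun ψ j => Function.update ψ j (finitoPoint s f ψ)) φ) ≤
      (n - 1 / 2) ^ k * finitoPotential s f φ := by
  induction k generalizing φ with
  | zero => simp
  | succ k ih =>
    rw [← (Fin.consEquiv fun _ => Fin n).sum_comp, Fintype.sum_prod_type]
    simp only [Fin.consEquiv, Equiv.coe_fn_mk, List.ofFn_cons, List.foldl_cons]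
    refine (Finset.sum_le_sum fun j _ => ih _).trans ?_
    rw [← Finset.mul_sum, pow_succ, mul_assoc]
    have hn1 : (1 : ℝ) ≤ n := by exact_mod_cast hn
    exact mul_le_mul_of_nonneg_left
      (sum_finitoPotential_update_le hn hdiff hs hL hsc hlip hbig φ)
      (pow_nonneg (by linarith) k)

lemma gradient_mean {f : Fin n → E → ℝ} (hdiff : ∀ i, Differentiable ℝ (f i)) (x : E) :
    gradient (fun x => (1 / (n : ℝ)) * ∑ i, f i x) x = meanGradient f fun _ => x := by
  refine HasGradientAt.gradient ?_
  rw [hasGradientAt_iff_hasFDerivAt, meanGradient, tableMean, map_smul, map_sum]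
  simp only [toDual_gradient]
  exact (HasFDerivAt.fun_sum fun i _ => (hdiff i x).hasFDerivAt).const_mul (1 / (n : ℝ))

end Finito

/-- (Main theorem, β = 2 case) Suppose `n ≥ 2L/s` and `α = 2`. Starting from the
all-`x₀` table and applying the Finito iteration `k` times along an index sequence `σ`,
the average over all `σ ∈ {1,…,n}ᵏ` of `f` at the table mean satisfies
`(1/nᵏ) ∑_σ f(φbar⁽ᵏ⁾(σ)) - f(w*) ≤ (3/(4s)) (1 - 1/(2n))ᵏ ‖∇f(x₀)‖²`. -/
theorem finito_convergence_rate_beta_two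
    {E : Type*} [NormedAddCommGroup E] [InnerProductSpace ℝ E] [FiniteDimensional ℝ E]
    (n : ℕ) (hn : 1 ≤ n) (f : Fin n → E → ℝ)
    (hdiff : ∀ i, Differentiable ℝ (f i))
    (s : ℝ) (hs : 0 < s)
    (hsc : ∀ i, StrongConvexOn Set.univ s (f i))
    (L : ℝ) (hL : 0 < L)
    (hlip : ∀ i, ∀ x y : E, ‖gradient (f i) x - gradient (f i) y‖ ≤ L * ‖x - y‖)
    (F : E → ℝ) (hF : F = fun x => (1/(n:ℝ)) * ∑ i, f i x)
    (wstar : E) (hmin : ∀ y, F wstar ≤ F y)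
    (hbig : (n:ℝ) ≥ 2 * L / s)
    (x₀ : E) (k : ℕ)
    -- one step of the Finito iteration with step size α = 2
    (step : (Fin n → E) → Fin n → (Fin n → E))
    (hstep : ∀ (ψ : Fin n → E) (j : Fin n),
      step ψ j = Function.update ψ j
        (((1/(n:ℝ)) • ∑ i, ψ i)
          - ((1/(2 * s * (n:ℝ))) • ∑ i, gradient (f i) (ψ i)))) :
    ((1/(n:ℝ)^k) * ∑ σ : Fin k → Fin n,
        F ((1/(n:ℝ)) • ∑ i, (List.ofFn σ).foldl step (fun _ => x₀) i)) - F wstar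
      ≤ (3/(4*s)) * (1 - 1/(2 * (n:ℝ)))^k * ‖gradient F x₀‖^2 := by
  subst hF
  have hn0 : (0 : ℝ) < n := by positivity
  have hstep' : step = fun ψ j => Function.update ψ j (finitoPoint s f ψ) := by
    funext ψ j
    rw [hstep, finitoPoint, meanGradient, tableMean, tableMean, smul_smul]
    congr 4
    field_simp
  have hbig' : 2 * L ≤ s * n := by
    rw [ge_iff_le, div_le_iff₀ hs] at hbig
    linarith
  have hsum := sum_finitoPotential_foldl_le hn hdiff hs hL hsc hlip hbig' k fun _ => x₀
  rw [← hstep'] at hsum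
  have hx₀ : finitoPotential s f (fun _ => x₀) =
      n * (3 / (8 * s) * ‖meanGradient f fun _ => x₀‖ ^ 2) := by
    have hm : tableMean (fun _ : Fin n => x₀) = x₀ := by
      simp [tableMean, ← Nat.cast_smul_eq_nsmul ℝ, smul_smul, hn0.ne']
    simp [finitoPotential, sumLinearization, hm]
  have hsub := Finset.sum_le_sum fun (σ : Fin k → Fin n) (_ : σ ∈ Finset.univ) =>
    sum_sub_sum_le_finitoPotential hn hdiff hs hsc
      ((List.ofFn σ).foldl step fun _ => x₀) wstar
  rw [Finset.sum_sub_distrib, ← Finset.mul_sum] at hsub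
  simp only [Finset.sum_const, Finset.card_univ, Fintype.card_fun, Fintype.card_fin,
    nsmul_eq_mul, Nat.cast_pow] at hsub
  rw [gradient_mean hdiff, ← Finset.mul_sum]
  rw [hx₀] at hsum
  have hpow : (1 - 1 / (2 * (n : ℝ))) ^ k = (n - 1 / 2) ^ k / (n : ℝ) ^ k := by
    rw [← div_pow]
    congr 1
    field_simp
  rw [hpow]
  simp only [tableMean] at hsub
  have hnk : (0 : ℝ) < (n : ℝ) ^ k := by positivity
  have h := hsub.trans (mul_le_mul_of_nonneg_left hsum zero_le_two)
  generalize (∑ σ : Fin k → Fin n, ∑ i, f i _) = A at *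
  rw [← mul_le_mul_iff_right₀ (mul_pos hnk hn0)]
  refine le_trans (le_of_eq ?_) (h.trans (le_of_eq ?_))
  · field_simp
  · field_simp
    ring
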